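/- arXiv:1208.1688 — 4 statements merged into one kernel-verified Lean document; each statement's English description precedes it below -/
import Mathlib

section
/- Let G be a finite simple bipartite graph with bipartition (A, B) such that A is a vertex cover of G, and let k be a positive integer. If C is a vertex cover of G with |C| < |A| and dist(A, C) ≤ 2k − 1, then there exists a set S ⊆ A with |S| ≤ k and |N(S)| < |S|. -/
variable {V : Type*}

/-- `S` is a vertex cover of `G`: every edge has at least one endpoint in `S`. -/
def IsVertexCover (G : SimpleGraph V) (S : Set V) : Prop :=
  ∀ ⦃u v : V⦄, G.Adj u v → u ∈ S ∨ v ∈ S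

/-- `S` is an independent set of `G`: no edge has both endpoints in `S`. -/
def IsIndepSet (G : SimpleGraph V) (S : Set V) : Prop :=
  ∀ ⦃u : V⦄, u ∈ S → ∀ ⦃v : V⦄, v ∈ S → ¬ G.Adj u v

/-- `nbhd G S = N(S)`: vertices outside `S` adjacent to at least one vertex of `S`. -/
def nbhd (G : SimpleGraph V) (S : Set V) : Set V :=
  {v : V | v ∉ S ∧ ∃ s ∈ S, G.Adj s v}

/-- `dist(S₁,S₂) = |S₁ ∪ S₂| − |S₁ ∩ S₂|` (the size of the symmetric difference). -/
noncomputable def setDist (S₁ S₂ : Set V) : ℕ :=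
  (S₁ ∪ S₂).ncard - (S₁ ∩ S₂).ncard

/-- The distance of two finite sets is the sum of the sizes of their two differences. -/
theorem setDist_eq_ncard_diff_add_ncard_diff [Finite V] (S T : Set V) :
    setDist S T = (S \ T).ncard + (T \ S).ncard := by
  have h₁ := Set.ncard_union_add_ncard_inter S T
  have h₂ := Set.ncard_inter_add_ncard_sdiff_eq_ncard S T
  have h₃ := Set.ncard_inter_add_ncard_sdiff_eq_ncard T S
  rw [Set.inter_comm T S] at h₃
  unfold setDist
  omega

/-- If `A` is independent and `C` is a vertex cover, every neighbour of a vertex of `A \ C`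
lies in `C \ A`. -/
theorem nbhd_subset_diff_of_isVertexCover {G : SimpleGraph V} {A C S : Set V}
    (hA : IsIndepSet G A) (hC : IsVertexCover G C) (hS : S ⊆ A \ C) :
    nbhd G S ⊆ C \ A := by
  rintro v ⟨-, s, hs, hsv⟩
  exact ⟨(hC hsv).resolve_left (hS hs).2, fun hv => hA (hS hs).1 hv hsv⟩

/-- in a bipartite graph with bipartition `(A,B)` where `A` is a vertex cover,
a vertex cover `C` with `|C| < |A|` within distance `2k - 1` of `A` yields a Hall set
`S ⊆ A` of size at most `k`. -/
theorem stmt2 [Fintype V] (G : SimpleGraph V) (A B : Set V) (k : ℕ)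
    (hunion : A ∪ B = Set.univ) (hdisj : A ∩ B = ∅)
    (hAi : IsIndepSet G A) (hBi : IsIndepSet G B)
    (hvc : IsVertexCover G A) (hk : 0 < k)
    (C : Set V) (hC : IsVertexCover G C) (hCA : C.ncard < A.ncard)
    (hdist : setDist A C ≤ 2 * k - 1) :
    ∃ S : Set V, S ⊆ A ∧ S.ncard ≤ k ∧ (nbhd G S).ncard < S.ncard := by
  rw [setDist_eq_ncard_diff_add_ncard_diff] at hdist
  have hlt : (C \ A).ncard < (A \ C).ncard := by
    have h₁ := Set.ncard_inter_add_ncard_sdiff_eq_ncard A C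
    have h₂ := Set.ncard_inter_add_ncard_sdiff_eq_ncard C A
    rw [Set.inter_comm C A] at h₂
    omega
  obtain ⟨S, hS, hcard⟩ := Set.exists_subset_card_eq (Nat.succ_le_of_lt hlt)
  have hN := Set.ncard_le_ncard (nbhd_subset_diff_of_isVertexCover hAi hC hS)
  exact ⟨S, hS.trans Set.sdiff_subset, by omega, by omega⟩
end

section
/- Let G = (V, E) be a finite simple graph, let k ≥ 4 be an integer, set t = C(k,2) − k − 1, and let H be the bipartite graph of the Hall-set construction with parts A = {v_e : e ∈ E} and B = V ∪ U, |U| = t. If S ⊆ A is a set with |S| ≤ C(k,2) and |N_H(S)| < |S|, then |S| = C(k,2), |V ∩ N_H(S)| = k, and V ∩ N_H(S) is a clique of size k in G. -/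
variable {V : Type*}

/-- Vertex set of the Hall-set construction: `A = {vₑ : e ∈ E}` (left summand) and
`B = V ∪ U` with `|U| = t` (right summand). -/
abbrev HallV (G : SimpleGraph V) (t : ℕ) : Type _ := ↥G.edgeSet ⊕ (V ⊕ Fin t)

/-- The bipartite graph of the Hall-set construction: `vₑ` is adjacent to both endpoints
of `e` and to every vertex of `U`; there are no other edges. -/
def hallGraph (G : SimpleGraph V) (t : ℕ) : SimpleGraph (HallV G t) :=
  SimpleGraph.fromRel (fun x y =>
    ∃ e : G.edgeSet, x = Sum.inl e ∧
      ((∃ v : V, y = Sum.inr (Sum.inl v) ∧ v ∈ (e : Sym2 V)) ∨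
       (∃ u : Fin t, y = Sum.inr (Sum.inr u))))

theorem hallGraph_adj_inl_inr_inl (G : SimpleGraph V) (t : ℕ) (e : G.edgeSet) (v : V) :
    (hallGraph G t).Adj (Sum.inl e) (Sum.inr (Sum.inl v)) ↔ v ∈ (e : Sym2 V) := by
  simp [hallGraph]

theorem hallGraph_adj_inl_inr_inr (G : SimpleGraph V) (t : ℕ) (e : G.edgeSet) (u : Fin t) :
    (hallGraph G t).Adj (Sum.inl e) (Sum.inr (Sum.inr u)) := by
  simp [hallGraph]

theorem not_hallGraph_adj_inl_inl (G : SimpleGraph V) (t : ℕ) (e f : G.edgeSet) :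
    ¬ (hallGraph G t).Adj (Sum.inl e) (Sum.inl f) := by
  simp [hallGraph]

/-- The neighbourhood of the image of a set `T` of edges, seen in `V`, is the set of endpoints
of the edges in `T`. -/
theorem inr_inl_mem_nbhd_hallGraph_iff (G : SimpleGraph V) (t : ℕ) (T : Set G.edgeSet) (v : V) :
    Sum.inr (Sum.inl v) ∈ nbhd (hallGraph G t) (Sum.inl '' T) ↔ ∃ e ∈ T, v ∈ (e : Sym2 V) := by
  simp only [nbhd, Set.mem_ofPred_eq, Set.exists_mem_image, hallGraph_adj_inl_inr_inl]
  simp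

/-- A nonempty set of edges is adjacent to all of `U`, so its neighbourhood has exactly `t`
elements outside `V`. -/
theorem ncard_nbhd_hallGraph [Finite V] (G : SimpleGraph V) (t : ℕ) {T : Set G.edgeSet}
    (hT : T.Nonempty) :
    (nbhd (hallGraph G t) (Sum.inl '' T)).ncard =
      {v : V | Sum.inr (Sum.inl v) ∈ nbhd (hallGraph G t) (Sum.inl '' T)}.ncard + t := by
  set W := {v : V | Sum.inr (Sum.inl v) ∈ nbhd (hallGraph G t) (Sum.inl '' T)} with hW
  have key : nbhd (hallGraph G t) (Sum.inl '' T) =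
      (fun v => Sum.inr (Sum.inl v)) '' W ∪ Set.range (fun u => Sum.inr (Sum.inr u)) := by
    ext x
    rcases x with e | v | u
    · simp [nbhd, not_hallGraph_adj_inl_inl]
    · simp [hW]
    · obtain ⟨e, he⟩ := hT
      simp only [nbhd, Set.mem_ofPred_eq, Set.exists_mem_image, hallGraph_adj_inl_inr_inr]
      simpa using ⟨_, _, he⟩
  rw [key, Set.ncard_union_eq, Set.ncard_image_of_injective, ← Set.image_univ,
    Set.ncard_image_of_injective, Set.ncard_univ, Nat.card_fin]
  · exact Sum.inr_injective.comp Sum.inr_injective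
  · exact Sum.inr_injective.comp Sum.inl_injective
  · rw [Set.disjoint_left]
    rintro _ ⟨v, -, rfl⟩ ⟨u, hu⟩
    simp at hu

theorem choose_two_add_lt_choose_two_add {w k : ℕ} (hk : 4 ≤ k) (hwk : w < k) :
    w.choose 2 + k < k.choose 2 + w := by
  obtain ⟨d, rfl⟩ := Nat.exists_eq_add_of_lt hwk
  qify
  rw [Nat.cast_choose_two, Nat.cast_choose_two]
  have : (4 : ℚ) ≤ w + d + 1 := by exact_mod_cast hk
  have hd : (0 : ℚ) ≤ d := d.cast_nonneg
  have hw : (0 : ℚ) ≤ w := w.cast_nonneg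
  push_cast
  nlinarith [mul_nonneg hd hw]

/-- in the Hall-set construction `H`, a set `S ⊆ A` with `|S| ≤ C(k,2)` and
`|N_H(S)| < |S|` satisfies `|S| = C(k,2)`, `|V ∩ N_H(S)| = k`, and `V ∩ N_H(S)` is a
clique of size `k` in `G`. -/
theorem stmt4 [Fintype V] (G : SimpleGraph V) (k t : ℕ) (hk : 4 ≤ k)
    (ht : t = k.choose 2 - k - 1)
    (S : Set (HallV G t)) (hSA : ∀ x ∈ S, ∃ e : G.edgeSet, x = Sum.inl e)
    (hcard : S.ncard ≤ k.choose 2)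
    (hHall : (nbhd (hallGraph G t) S).ncard < S.ncard) :
    S.ncard = k.choose 2 ∧
      ({v : V | Sum.inr (Sum.inl v) ∈ nbhd (hallGraph G t) S}).ncard = k ∧
      G.IsClique {v : V | Sum.inr (Sum.inl v) ∈ nbhd (hallGraph G t) S} := by
  classical
  obtain ⟨T, rfl⟩ : ∃ T : Set G.edgeSet, S = Sum.inl '' T :=
    ⟨Sum.inl ⁻¹' S, (Set.image_preimage_eq_of_subset fun x hx => by
      obtain ⟨e, rfl⟩ := hSA x hx
      exact ⟨e, rfl⟩).symm⟩
  have hT : T.Nonempty := by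
    rw [Set.nonempty_iff_ne_empty]
    rintro rfl
    simp at hHall
  rw [ncard_nbhd_hallGraph G t hT] at hHall
  set W := {v : V | Sum.inr (Sum.inl v) ∈ nbhd (hallGraph G t) (Sum.inl '' T)} with hW
  have hS : (Sum.inl '' T : Set (HallV G t)).ncard =
      (Subtype.val '' T : Set (Sym2 V)).toFinset.card := by
    rw [← Set.ncard_eq_toFinset_card', Set.ncard_image_of_injective _ Sum.inl_injective,
      Set.ncard_image_of_injective _ Subtype.val_injective]
  have hsub : (Subtype.val '' T : Set (Sym2 V)).toFinset ⊆
      W.toFinset.offDiag.image Sym2.mk.uncurry := by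
    intro e he
    rw [Set.mem_toFinset] at he
    obtain ⟨⟨e, heG⟩, heT, rfl⟩ := he
    have hmem : ∀ v ∈ e, v ∈ W := fun v hv =>
      (inr_inl_mem_nbhd_hallGraph_iff G t T v).2 ⟨_, heT, hv⟩
    induction e with | _ a b =>
    refine Finset.mem_image.2 ⟨(a, b), ?_, rfl⟩
    simp only [Finset.mem_offDiag, Set.mem_toFinset]
    exact ⟨hmem a (Sym2.mem_mk_left a b), hmem b (Sym2.mem_mk_right a b),
      G.ne_of_adj heG⟩
  have hWcard : (W.toFinset.offDiag.image Sym2.mk.uncurry).card = W.ncard.choose 2 := by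
    rw [Set.ncard_eq_toFinset_card', ← Sym2.card_image_offDiag]
  have hle := Finset.card_le_card hsub
  rw [hWcard, ← hS] at hle
  have hk' : 3 + k < k.choose 2 + 3 :=
    choose_two_add_lt_choose_two_add hk (w := 3) (by omega)
  have hWk : W.ncard = k := by
    by_contra hne
    have := choose_two_add_lt_choose_two_add hk (w := W.ncard) (by omega)
    omega
  have hSk : (Sum.inl '' T : Set (HallV G t)).ncard = k.choose 2 := by omega
  refine ⟨hSk, hWk, fun a ha b hb hab => ?_⟩
  have heq := Finset.eq_of_subset_of_card_le hsub (by rw [hWcard, ← hS, hSk, hWk])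
  have hab' : s(a, b) ∈ (Subtype.val '' T : Set (Sym2 V)).toFinset := by
    rw [heq]
    exact Finset.mem_image.2 ⟨(a, b), by simp [ha, hb, hab], rfl⟩
  rw [Set.mem_toFinset] at hab'
  obtain ⟨⟨e, he⟩, -, rfl⟩ := hab'
  exact he
end

section
/- Let G = (V, E) be a finite simple graph, let k ≥ 4 be an integer, set t = C(k,2) − k − 1 and k' = (3 + t)·C(k,2), let H be the bipartite Hall-set construction for (G, k), and let G' be the 2-subdivision of H with bipartition (A', B') where A ⊆ A' and B ⊆ B'. If C ⊆ V is a clique of size k in G, then the set S' = S ∪ N²_{G'}(S), where S = {v_e : both endpoints of e lie in C}, satisfies S' ⊆ A', |S'| = k', and |N_{G'}(S')| = k' − 1. -/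
variable {V : Type*}

/-- Vertex set of the 2-subdivision: the original vertices plus, for each edge `xy`,
the two new vertices `z_{xy}` and `z'_{xy}`, encoded as the darts `(x,y)` and `(y,x)`. -/
abbrev SubdivV (G : SimpleGraph V) : Type _ := V ⊕ {p : V × V // G.Adj p.1 p.2}

/-- The 2-subdivision of `G`: each edge `xy` is replaced by the path
`x — z_{xy} — z'_{xy} — y`, where `z_{xy}` is the dart `(x,y)` and `z'_{xy}` the dart
`(y,x)`; a dart is adjacent to its first coordinate and to the reverse dart. -/
def subdiv2 (G : SimpleGraph V) : SimpleGraph (SubdivV G) :=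
  SimpleGraph.fromRel (fun x y =>
    (∃ d : {p : V × V // G.Adj p.1 p.2}, x = Sum.inl d.val.1 ∧ y = Sum.inr d) ∨
    (∃ d d' : {p : V × V // G.Adj p.1 p.2},
      x = Sum.inr d ∧ y = Sum.inr d' ∧ d.val.1 = d'.val.2 ∧ d.val.2 = d'.val.1))

/-- `N²(S)`: the set of vertices at distance exactly 2 from some vertex of `S`. -/
def nbhd2 (G : SimpleGraph V) (S : Set V) : Set V :=
  {w : V | ∃ s ∈ S, G.dist s w = 2}

/-- The part `A' = A ∪ {z'_{ab} : ab ∈ E(H)}` of the bipartition of the 2-subdivision of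
the Hall-set construction graph (`z'_{ab}`, the subdivision vertex adjacent to `b ∈ B`,
is the dart whose first coordinate lies in `B`). -/
def hallA' (G : SimpleGraph V) (t : ℕ) : Set (SubdivV (hallGraph G t)) :=
  {x | (∃ e : G.edgeSet, x = Sum.inl (Sum.inl e)) ∨
       (∃ d : {p : HallV G t × HallV G t // (hallGraph G t).Adj p.1 p.2},
          x = Sum.inr d ∧ ∃ w : V ⊕ Fin t, d.val.1 = Sum.inr w)}

lemma nbhd2_eq (G : SimpleGraph V) (S : Set V) :
    nbhd2 G S = {w | ∃ s ∈ S, s ≠ w ∧ ¬ G.Adj s w ∧ ∃ x, G.Adj s x ∧ G.Adj x w} := by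
  ext w
  simp only [nbhd2, Set.mem_ofPred_eq]
  refine exists_congr fun s => and_congr_right fun _ => ⟨fun h => ?_, ?_⟩
  · refine ⟨?_, ?_, ?_⟩
    · rintro rfl
      simp at h
    · intro hadj
      rw [SimpleGraph.dist_eq_one_iff_adj.2 hadj] at h
      omega
    · obtain ⟨p, hp⟩ := SimpleGraph.exists_walk_of_dist_ne_zero (G := G) (u := s) (v := w) (by omega)
      rw [h] at hp
      match p, hp with
      | .cons h1 (.cons h2 .nil), _ => exact ⟨_, h1, h2⟩
  · rintro ⟨hne, hadj, x, h1, h2⟩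
    have hle := SimpleGraph.dist_le (SimpleGraph.Walk.cons h1 (.cons h2 .nil))
    have h0 := (SimpleGraph.Walk.cons h1 (.cons h2 .nil)).reachable.pos_dist_of_ne hne
    have hone := mt SimpleGraph.dist_eq_one_iff_adj.1 hadj
    simp only [SimpleGraph.Walk.length_cons, SimpleGraph.Walk.length_nil] at hle
    omega

section Subdivision

variable {G : SimpleGraph V}

lemma subdiv2_adj_inl_inl (x y : V) : ¬ (subdiv2 G).Adj (.inl x) (.inl y) := by
  simp [subdiv2]

lemma subdiv2_adj_inl_inr (x : V) (d : {p : V × V // G.Adj p.1 p.2}) :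
    (subdiv2 G).Adj (.inl x) (.inr d) ↔ d.1.1 = x := by
  simp only [subdiv2, SimpleGraph.fromRel_adj]
  grind

lemma subdiv2_adj_inr_inr (d d' : {p : V × V // G.Adj p.1 p.2}) :
    (subdiv2 G).Adj (.inr d) (.inr d') ↔ d.1.1 = d'.1.2 ∧ d.1.2 = d'.1.1 := by
  have := d.2.ne
  simp only [subdiv2, SimpleGraph.fromRel_adj]
  grind

end Subdivision

section Hall

variable {G : SimpleGraph V} {t : ℕ}

lemma hallGraph_adj_inl_inl (e e' : G.edgeSet) :
    ¬ (hallGraph G t).Adj (.inl e) (.inl e') := by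
  simp [hallGraph]

lemma hallGraph_adj_inr_inr (b b' : V ⊕ Fin t) :
    ¬ (hallGraph G t).Adj (.inr b) (.inr b') := by
  simp [hallGraph]

lemma hallGraph_adj_inl_vertex (e : G.edgeSet) (v : V) :
    (hallGraph G t).Adj (.inl e) (.inr (.inl v)) ↔ v ∈ (e : Sym2 V) := by
  simp [hallGraph]

lemma hallGraph_adj_inl_extra (e : G.edgeSet) (u : Fin t) :
    (hallGraph G t).Adj (.inl e) (.inr (.inr u)) := by
  simp [hallGraph]

lemma ncard_hallGraph_neighbors (e : G.edgeSet) :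
    {b : V ⊕ Fin t | (hallGraph G t).Adj (.inl e) (.inr b)}.ncard = 2 + t := by
  obtain ⟨⟨a, b⟩, he⟩ := e
  have hab : a ≠ b := G.ne_of_adj he
  have : {x : V ⊕ Fin t | (hallGraph G t).Adj (.inl ⟨s(a, b), he⟩) (.inr x)} =
      Sum.inl '' {a, b} ∪ Sum.inr '' Set.univ := by
    ext (v | u)
    · simp [hallGraph_adj_inl_vertex]
    · simp [hallGraph_adj_inl_extra]
  change {x : V ⊕ Fin t | (hallGraph G t).Adj (.inl ⟨s(a, b), he⟩) (.inr x)}.ncard = 2 + t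
  rw [this, Set.ncard_union_eq (by simp [Set.disjoint_left]) (Set.toFinite _) (Set.toFinite _),
    Set.ncard_image_of_injective _ Sum.inl_injective,
    Set.ncard_image_of_injective _ Sum.inr_injective, Set.ncard_pair hab, Set.ncard_univ]
  simp

lemma ncard_clique_edges {C : Set V} (hC : G.IsClique C) (hfin : C.Finite) :
    {e : G.edgeSet | ∀ v ∈ (e : Sym2 V), v ∈ C}.ncard = C.ncard.choose 2 := by
  classical
  have himg : Subtype.val '' {e : G.edgeSet | ∀ v ∈ (e : Sym2 V), v ∈ C} =
      (hfin.toFinset.offDiag.image Sym2.mk.uncurry : Set (Sym2 V)) := by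
    ext ⟨a, b⟩
    change s(a, b) ∈ _ ↔ s(a, b) ∈ _
    simp only [Set.mem_image, Set.mem_ofPred_eq, Subtype.exists, exists_and_right, exists_eq_right,
      Finset.coe_image, Finset.mem_coe, Finset.mem_offDiag, Set.Finite.mem_toFinset, Prod.exists,
      Function.uncurry_apply_pair, SimpleGraph.mem_edgeSet]
    constructor
    · rintro ⟨hadj, h⟩
      exact ⟨a, b, ⟨h a (by simp), h b (by simp), hadj.ne⟩, rfl⟩
    · rintro ⟨x, y, ⟨hx, hy, hne⟩, hxy⟩
      rw [← SimpleGraph.mem_edgeSet, ← hxy]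
      exact ⟨hC hx hy hne, by simp [hx, hy]⟩
  rw [← Set.ncard_image_of_injective _ Subtype.val_injective, himg, Set.ncard_coe_finset,
    Sym2.card_image_offDiag, Set.ncard_eq_toFinset_card C hfin]

lemma ncard_incidences [Finite V] (M : Set G.edgeSet) :
    {p : G.edgeSet × (V ⊕ Fin t) | p.1 ∈ M ∧ (hallGraph G t).Adj (.inl p.1) (.inr p.2)}.ncard =
      M.ncard * (2 + t) := by
  have := Fintype.ofFinite M
  let f : {p : G.edgeSet × (V ⊕ Fin t) // p.1 ∈ M ∧ (hallGraph G t).Adj (.inl p.1) (.inr p.2)} ≃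
      Σ e : M, {b : V ⊕ Fin t | (hallGraph G t).Adj (.inl e.1) (.inr b)} :=
    { toFun := fun p => ⟨⟨p.1.1, p.2.1⟩, ⟨p.1.2, p.2.2⟩⟩
      invFun := fun q => ⟨(q.1.1, q.2.1), q.1.2, q.2.2⟩
      left_inv := fun _ => rfl
      right_inv := fun _ => rfl }
  rw [← Nat.card_coe_set_eq]
  refine (Nat.card_congr f).trans ?_
  rw [Nat.card_sigma]
  simp only [Nat.card_coe_set_eq, ncard_hallGraph_neighbors]
  simp [← Nat.card_eq_fintype_card]

lemma ncard_darts_fst [Finite V] (M : Set G.edgeSet) :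
    {d : {p : HallV G t × HallV G t // (hallGraph G t).Adj p.1 p.2} |
      ∃ e ∈ M, d.1.1 = .inl e}.ncard = M.ncard * (2 + t) := by
  rw [← ncard_incidences M]
  symm
  refine Set.ncard_congr (fun p hp => ⟨(.inl p.1, .inr p.2), hp.2⟩) ?_ ?_ ?_
  · rintro ⟨e, b⟩ h
    exact ⟨e, h.1, rfl⟩
  · rintro ⟨e, b⟩ ⟨e', b'⟩ h h' heq
    simpa using heq
  · rintro ⟨⟨x, y⟩, hd⟩ ⟨e, he, h⟩
    obtain rfl : x = .inl e := h
    rcases y with e' | b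
    · exact (hallGraph_adj_inl_inl _ _ hd).elim
    · exact ⟨(e, b), ⟨he, hd⟩, rfl⟩

lemma ncard_darts_snd [Finite V] (M : Set G.edgeSet) :
    {d : {p : HallV G t × HallV G t // (hallGraph G t).Adj p.1 p.2} |
      ∃ e ∈ M, d.1.2 = .inl e}.ncard = M.ncard * (2 + t) := by
  rw [← ncard_darts_fst M]
  refine Set.ncard_congr (fun d _ => ⟨d.1.swap, d.2.symm⟩) ?_ ?_ ?_
  · exact fun d h => h
  · intro d d' _ _ heq
    exact Subtype.ext (Prod.swap_injective (Subtype.ext_iff.1 heq))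
  · exact fun d h => ⟨⟨d.1.swap, d.2.symm⟩, h, rfl⟩

lemma nbhd2_edges (M : Set G.edgeSet) :
    nbhd2 (subdiv2 (hallGraph G t)) ((fun e => .inl (.inl e)) '' M) =
      Sum.inr '' {d | ∃ e ∈ M, d.1.2 = .inl e} := by
  rw [nbhd2_eq]
  ext (x | d)
  · simp only [Set.mem_ofPred_eq, Set.exists_mem_image]
    simp only [Set.mem_image, reduceCtorEq, and_false, exists_false, iff_false]
    rintro ⟨e, he, hne, -, (y | d), h1, h2⟩
    · exact subdiv2_adj_inl_inl _ _ h1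
    · rw [subdiv2_adj_inl_inr] at h1
      rw [SimpleGraph.adj_comm, subdiv2_adj_inl_inr] at h2
      exact hne (congrArg Sum.inl (h1.symm.trans h2))
  · simp only [Set.mem_ofPred_eq, Set.exists_mem_image]
    simp only [Set.mem_image, Set.mem_ofPred_eq, Sum.inr.injEq, exists_eq_right]
    refine exists_congr fun e => and_congr_right fun he => ⟨?_, fun h => ?_⟩
    · rintro ⟨-, hadj, (y | d'), h1, h2⟩
      · exact (subdiv2_adj_inl_inl _ _ h1).elim
      · rw [subdiv2_adj_inl_inr] at h1
        rw [subdiv2_adj_inr_inr] at h2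
        exact h2.1.symm.trans h1
    · refine ⟨by simp, fun hadj => ?_, .inr ⟨d.1.swap, d.2.symm⟩, ?_, ?_⟩
      · rw [subdiv2_adj_inl_inr] at hadj
        exact d.2.ne (hadj.trans h.symm)
      · rw [subdiv2_adj_inl_inr]
        exact h
      · rw [subdiv2_adj_inr_inr]
        exact ⟨rfl, rfl⟩

lemma nbhd_edges_union (M : Set G.edgeSet) :
    nbhd (subdiv2 (hallGraph G t))
        ((fun e => .inl (.inl e)) '' M ∪ Sum.inr '' {d | ∃ e ∈ M, d.1.2 = .inl e}) =
      Sum.inr '' {d | ∃ e ∈ M, d.1.1 = .inl e} ∪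
        (fun b => .inl (.inr b)) '' {b | ∃ e ∈ M, (hallGraph G t).Adj (.inl e) (.inr b)} := by
  ext x
  simp only [nbhd, Set.mem_ofPred_eq, Set.mem_union, or_and_right, exists_or,
    Set.exists_mem_image]
  rcases x with (e | b) | d
  · simp only [subdiv2_adj_inl_inl, Set.mem_image]
    simp only [reduceCtorEq, Sum.inl.injEq, and_false, exists_false, false_or, or_false,
      iff_false]
    rintro ⟨-, d, ⟨e', -, h1⟩, h2⟩
    rw [SimpleGraph.adj_comm, subdiv2_adj_inl_inr] at h2
    exact hallGraph_adj_inl_inl _ _ (h1 ▸ h2 ▸ d.2)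
  · simp only [subdiv2_adj_inl_inl, Set.mem_image, Set.mem_ofPred_eq]
    simp only [reduceCtorEq, Sum.inl.injEq, Sum.inr.injEq, and_false, exists_false, false_or,
      or_false, exists_eq_right, not_false_eq_true, true_and]
    constructor
    · rintro ⟨d, ⟨e, he, h1⟩, h2⟩
      rw [SimpleGraph.adj_comm, subdiv2_adj_inl_inr] at h2
      exact ⟨e, he, h1 ▸ h2 ▸ d.2.symm⟩
    · rintro ⟨e, he, h⟩
      refine ⟨⟨(.inr b, .inl e), h.symm⟩, ⟨e, he, rfl⟩, ?_⟩
      rw [SimpleGraph.adj_comm, subdiv2_adj_inl_inr]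
  · simp only [subdiv2_adj_inl_inr, subdiv2_adj_inr_inr, Set.mem_image, Set.mem_ofPred_eq]
    simp only [reduceCtorEq, Sum.inr.injEq, and_false, exists_false, false_or,
      or_false, exists_eq_right]
    constructor
    · rintro ⟨-, h | ⟨d', ⟨e, he, h1⟩, -, h2⟩⟩
      · exact h
      · exact ⟨e, he, h2.symm.trans h1⟩
    · rintro ⟨e, he, h⟩
      refine ⟨?_, .inl ⟨e, he, h⟩⟩
      rintro ⟨e', -, h'⟩
      exact hallGraph_adj_inl_inl _ _ (h ▸ h' ▸ d.2)

lemma ncard_clique_edges_neighbors [Finite V] {C : Set V} (hC : G.IsClique C)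
    (hcard : 2 ≤ C.ncard) :
    {b : V ⊕ Fin t | ∃ e ∈ {e : G.edgeSet | ∀ v ∈ (e : Sym2 V), v ∈ C},
      (hallGraph G t).Adj (.inl e) (.inr b)}.ncard = C.ncard + t := by
  have hedge : ∀ v ∈ C, ∃ e ∈ {e : G.edgeSet | ∀ v ∈ (e : Sym2 V), v ∈ C},
      v ∈ (e : Sym2 V) := by
    intro v hv
    obtain ⟨w, hw, hne⟩ := Set.exists_ne_of_one_lt_ncard hcard v
    refine ⟨⟨s(v, w), hC hv hw hne.symm⟩, ?_, by simp⟩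
    simp [hv, hw]
  have hset : {b : V ⊕ Fin t | ∃ e ∈ {e : G.edgeSet | ∀ v ∈ (e : Sym2 V), v ∈ C},
      (hallGraph G t).Adj (.inl e) (.inr b)} = Sum.inl '' C ∪ Sum.inr '' Set.univ := by
    ext (v | u)
    · simp only [hallGraph_adj_inl_vertex, Set.mem_ofPred_eq, Set.mem_union, Set.mem_image,
        Sum.inl.injEq, exists_eq_right, reduceCtorEq, and_false, exists_false, or_false]
      exact ⟨fun ⟨e, he, hv⟩ => he v hv, hedge v⟩
    · obtain ⟨v, hv⟩ := Set.nonempty_of_ncard_ne_zero (s := C) (by omega)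
      obtain ⟨e, he, -⟩ := hedge v hv
      exact iff_of_true ⟨e, he, hallGraph_adj_inl_extra e u⟩ (by simp)
  rw [hset, Set.ncard_union_eq (by simp [Set.disjoint_left]) (Set.toFinite _) (Set.toFinite _),
    Set.ncard_image_of_injective _ Sum.inl_injective,
    Set.ncard_image_of_injective _ Sum.inr_injective, Set.ncard_univ]
  simp

end Hall

/-- a clique `C` of size `k` in `G` yields, in the 2-subdivision `G'` of the
Hall-set construction, the set `S' = S ∪ N²_{G'}(S)` (where `S = {vₑ : e ⊆ C}`) with
`S' ⊆ A'`, `|S'| = k'` and `|N_{G'}(S')| = k' - 1`, where `k' = (3 + t)·C(k,2)`. -/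
theorem stmt6 [Fintype V] (G : SimpleGraph V) (k t k' : ℕ) (hk : 4 ≤ k)
    (ht : t = k.choose 2 - k - 1) (hk' : k' = (3 + t) * k.choose 2)
    (C : Set V) (hC : G.IsClique C) (hCk : C.ncard = k)
    (S S' : Set (SubdivV (hallGraph G t)))
    (hS : S = {x : SubdivV (hallGraph G t) |
      ∃ e : G.edgeSet, x = Sum.inl (Sum.inl e) ∧ ∀ v ∈ (e : Sym2 V), v ∈ C})
    (hS' : S' = S ∪ nbhd2 (subdiv2 (hallGraph G t)) S) :
    S' ⊆ hallA' G t ∧ S'.ncard = k' ∧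
      (nbhd (subdiv2 (hallGraph G t)) S').ncard = k' - 1 := by
  set M : Set G.edgeSet := {e | ∀ v ∈ (e : Sym2 V), v ∈ C} with hM
  have hSM : S = (fun e => .inl (.inl e)) '' M := by
    rw [hS]
    ext x
    exact ⟨fun ⟨e, hx, he⟩ => ⟨e, he, hx.symm⟩, fun ⟨e, he, hx⟩ => ⟨e, hx.symm, he⟩⟩
  have hMk : M.ncard = k.choose 2 := by rw [hM, ncard_clique_edges hC C.toFinite, hCk]
  rw [hSM, nbhd2_edges] at hS'
  have hchoose : k + 1 ≤ k.choose 2 := by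
    rw [Nat.choose_two_right, Nat.le_div_iff_mul_le two_pos]
    obtain ⟨n, rfl⟩ := Nat.exists_eq_add_of_le hk
    rw [show 4 + n - 1 = 3 + n by omega]
    nlinarith
  have hinl : Function.Injective
      (fun e => .inl (.inl e) : G.edgeSet → SubdivV (hallGraph G t)) :=
    Sum.inl_injective.comp Sum.inl_injective
  have hinr : Function.Injective
      (fun b => .inl (.inr b) : V ⊕ Fin t → SubdivV (hallGraph G t)) :=
    Sum.inl_injective.comp Sum.inr_injective
  subst hS'
  refine ⟨?_, ?_, ?_⟩
  · rintro _ (⟨e, -, rfl⟩ | ⟨d, ⟨e, -, h⟩, rfl⟩)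
    · exact .inl ⟨e, rfl⟩
    · refine .inr ⟨d, rfl, ?_⟩
      rcases hd : d.1.1 with e' | b
      · exact (hallGraph_adj_inl_inl _ _ (hd ▸ h ▸ d.2)).elim
      · exact ⟨b, rfl⟩
  · rw [Set.ncard_union_eq (by simp [Set.disjoint_left]) (Set.toFinite _) (Set.toFinite _),
      Set.ncard_image_of_injective _ hinl, Set.ncard_image_of_injective _ Sum.inr_injective,
      ncard_darts_snd, hMk, hk']
    ring
  · rw [nbhd_edges_union,
      Set.ncard_union_eq (by simp [Set.disjoint_left]) (Set.toFinite _) (Set.toFinite _),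
      Set.ncard_image_of_injective _ hinr, Set.ncard_image_of_injective _ Sum.inr_injective,
      ncard_darts_fst, hM, ncard_clique_edges_neighbors hC (by omega), ← hM, hMk, hCk, hk',
      show (3 + t) * k.choose 2 = k.choose 2 * (2 + t) + k.choose 2 by ring]
    omega
end

section
/- Let G = (V, E) be a finite simple graph, let S be a vertex cover of G, and let W ⊆ S be an independent set such that |N(W) \ S| < |W|. Then S' = (S \ W) ∪ (N(W) \ S) is a vertex cover of G with |S'| < |S|. -/
variable {V : Type*}

theorem IsVertexCover.exchange {G : SimpleGraph V} {S W : Set V}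
    (hvc : IsVertexCover G S) (hWi : IsIndepSet G W) :
    IsVertexCover G ((S \ W) ∪ (nbhd G W \ S)) := by
  have endpoint_mem : ∀ ⦃u v : V⦄, G.Adj u v → u ∈ W →
      v ∈ (S \ W) ∪ (nbhd G W \ S) := by
    intro u v huv hu
    have hv : v ∉ W := fun hv => hWi hu hv huv
    by_cases hvS : v ∈ S
    · exact Or.inl ⟨hvS, hv⟩
    · exact Or.inr ⟨⟨hv, u, hu, huv⟩, hvS⟩
  intro u v huv
  by_cases hu : u ∈ W
  · exact Or.inr (endpoint_mem huv hu)
  by_cases hv : v ∈ W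
  · exact Or.inl (endpoint_mem huv.symm hv)
  exact (hvc huv).imp (fun h => Or.inl ⟨h, hu⟩) (fun h => Or.inl ⟨h, hv⟩)

/-- if `S` is a vertex cover and `W ⊆ S` is independent with
`|N(W) \ S| < |W|`, then `S' = (S \ W) ∪ (N(W) \ S)` is a vertex cover with `|S'| < |S|`. -/
theorem stmt12 [Fintype V] (G : SimpleGraph V) (S W : Set V)
    (hvc : IsVertexCover G S) (hWS : W ⊆ S) (hWi : IsIndepSet G W)
    (hW : (nbhd G W \ S).ncard < W.ncard) :
    IsVertexCover G ((S \ W) ∪ (nbhd G W \ S)) ∧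
      ((S \ W) ∪ (nbhd G W \ S)).ncard < S.ncard := by
  refine ⟨hvc.exchange hWi, ?_⟩
  have hunion := Set.ncard_union_le (S \ W) (nbhd G W \ S)
  have hdiff := Set.ncard_sdiff_add_ncard_of_subset hWS (Set.toFinite S)
  omega
end
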